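/- If (Φ, E₊, E₋) is a generalized almost contact structure on W = V × V* and G is a compatible generalized metric, then (G∘Φ, E₋, E₊) is again a generalized almost contact structure on W and G is a compatible generalized metric for it: G∘Φ is skew-adjoint for the pairing, (G∘Φ)∘(G∘Φ) = −Id + E₋⊗E₊ + E₊⊗E₋, and −(G∘Φ)∘G∘(G∘Φ) = G − E₋⊗E₋ − E₊⊗E₊. -/

import Mathlib

open Module

noncomputable section

/-- The generalized tangent space `W = V × V*`. -/
abbrev GT (V : Type*) [AddCommGroup V] [Module ℝ V] := V × (V →ₗ[ℝ] ℝ)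

/-- The canonical symmetric pairing `⟨(X,α),(Y,β)⟩ = (β X + α Y)/2` on `W = V × V*`. -/
def gpair {V : Type*} [AddCommGroup V] [Module ℝ V] (u v : GT V) : ℝ :=
  (v.2 u.1 + u.2 v.1) / 2

section gpair

variable {V : Type*} [AddCommGroup V] [Module ℝ V]

lemma gpair_comm (u v : GT V) : gpair u v = gpair v u := by
  unfold gpair
  ring

lemma gpair_zero_left (v : GT V) : gpair 0 v = 0 := by
  simp [gpair]

/-- In a generalized almost contact structure, `Φ` annihilates its distinguished null vectors. -/
lemma gpair_skew_apply_eq_zero (Φ : GT V →ₗ[ℝ] GT V) (E F : GT V)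
    (hskew : ∀ u v : GT V, gpair (Φ u) v = - gpair u (Φ v))
    (hsq : ∀ w : GT V, Φ (Φ w) = -w + (2 * gpair F w) • E + (2 * gpair E w) • F)
    (hE : gpair E E = 0) (hEF : 2 * gpair E F = 1) : Φ E = 0 := by
  have hsqE : Φ (Φ E) = 0 := by
    rw [hsq, gpair_comm F E, hEF, hE]
    simp
  have horth : gpair E (Φ E) = 0 := by
    have h := hskew E E
    rw [gpair_comm] at h
    linarith
  have hparallel : Φ E = (2 * gpair F (Φ E)) • E := by
    have h := hsq (Φ E)
    rw [hsqE, map_zero, horth, mul_zero, zero_smul, add_zero] at h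
    exact neg_add_eq_zero.mp h.symm
  set c : ℝ := 2 * gpair F (Φ E)
  have hcc : c • c • E = 0 := by
    rw [← hparallel, ← map_smul, ← hparallel, hsqE]
  have hE0 : E ≠ 0 := by
    rintro rfl
    simp [gpair_zero_left] at hEF
  have hc : c = 0 := by simpa [hE0] using hcc
  rw [hparallel, hc, zero_smul]

end gpair

/-- For a generalized almost contact metric structure `(Φ, E₊, E₋, G)` on
`W = V × V*`, the triple `(G∘Φ, E₋, E₊)` is again a generalized almost contact structure
with compatible metric `G`: `G∘Φ` is skew-adjoint,
`(G∘Φ)∘(G∘Φ) = −Id + E₋⊗E₊ + E₊⊗E₋`, and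
`−(G∘Φ)∘G∘(G∘Φ) = G − E₋⊗E₋ − E₊⊗E₊`. -/
theorem stmt7 {V : Type*} [AddCommGroup V] [Module ℝ V] [FiniteDimensional ℝ V]
    (Φ : GT V →ₗ[ℝ] GT V) (Ep Em : GT V) (G : GT V →ₗ[ℝ] GT V)
    (hskew : ∀ u v : GT V, gpair (Φ u) v = - gpair u (Φ v))
    (hsq : ∀ w : GT V, Φ (Φ w) = -w + (2 * gpair Em w) • Ep + (2 * gpair Ep w) • Em)
    (hpp : gpair Ep Ep = 0) (hmm : gpair Em Em = 0)
    (hpm : 2 * gpair Ep Em = 1)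
    (hGsa : ∀ u v : GT V, gpair (G u) v = gpair u (G v))
    (hGsq : ∀ w : GT V, G (G w) = w)
    (hGc : ∀ w : GT V,
      -(Φ (G (Φ w))) = G w - (2 * gpair Ep w) • Ep - (2 * gpair Em w) • Em) :
    (∀ u v : GT V, gpair (G (Φ u)) v = - gpair u (G (Φ v))) ∧
    (∀ w : GT V,
      G (Φ (G (Φ w))) = -w + (2 * gpair Ep w) • Em + (2 * gpair Em w) • Ep) ∧
    (∀ w : GT V,
      -(G (Φ (G (G (Φ w))))) = G w - (2 * gpair Em w) • Em - (2 * gpair Ep w) • Ep) := by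
  have hEp : Φ Ep = 0 := gpair_skew_apply_eq_zero Φ Ep Em hskew hsq hpp hpm
  have hEm : Φ Em = 0 := by
    refine gpair_skew_apply_eq_zero Φ Em Ep hskew (fun w => ?_) hmm (by rwa [gpair_comm])
    rw [hsq]
    abel
  have hGEp : G Ep = Em := by
    have h := hGc Ep
    rw [hEp, hpp, gpair_comm Em Ep, hpm] at h
    simp only [map_zero, neg_zero, mul_zero, zero_smul, sub_zero, one_smul] at h
    exact sub_eq_zero.mp h.symm
  have hGEm : G Em = Ep := by rw [← hGEp, hGsq]
  have hcomm (w : GT V) : G (Φ w) = Φ (G w) := by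
    have hm : gpair Em (G (Φ w)) = 0 := by
      have h := hskew Ep w
      rw [hEp, gpair_zero_left] at h
      rw [← hGsa, hGEm]
      linarith
    have hp : gpair Ep (G (Φ w)) = 0 := by
      have h := hskew Em w
      rw [hEm, gpair_zero_left] at h
      rw [← hGsa, hGEp]
      linarith
    have h := congrArg Φ (hGc w)
    rw [map_neg, hsq, hm, hp] at h
    simpa [hEp, hEm] using h
  refine ⟨fun u v => ?_, fun w => ?_, fun w => ?_⟩
  · rw [hGsa, hskew, hcomm]
  · rw [← neg_neg (Φ (G (Φ w))), hGc]
    simp only [map_neg, map_sub, map_smul, hGsq, hGEp, hGEm]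
    abel
  · rw [hGsq, hsq]
    simp only [map_neg, map_add, map_smul, hGEp, hGEm]
    abel
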